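/- Let $K$ be a field of characteristic zero. An almost Poisson algebra $(A,[\cdot,\cdot],\cdot)$ over $K$ is a $K$-vector space $A$ with a commutative associative bilinear product $\cdot$ and a skew-symmetric bilinear bracket $[\cdot,\cdot]$ satisfying $[x,y\cdot z]=[x,y]\cdot z+y\cdot[x,z]$ for all $x,y,z\in A$. An almost tridendriform Poisson algebra $(A,[\cdot,\cdot],\diamond,\cdot,\vartriangleright)$ is an almost Poisson algebra $(A,[\cdot,\cdot],\cdot)$ with two further bilinear operations $\diamond,\vartriangleright$ such that, writing $$x*y=x\vartriangleright y+y\vartriangleright x+x\cdot y,\qquad \{x,y\}=x\diamond y-y\diamond x+[x,y],$$ the following hold for all $x,y,z\in A$: \begin{align*} (x*y)\vartriangleright z&=x\vartriangleright(y\vartriangleright z), & (x\vartriangleright y)\cdot z&=x\vartriangleright(y\cdot z),\\ x\diamond(y\cdot z)&=(x\diamond y)\cdot z+y\cdot(x\diamond z), & [x,z\vartriangleright y]&=z\vartriangleright[x,y]-y\cdot(z\diamond x),\\ (y*z)\diamond x&=z\vartriangleright(y\diamond x)+y\vartriangleright(z\diamond x), & \{x,z\}\vartriangleright y&=x\diamond(z\vartriangleright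 y)-z\vartriangleright(x\diamond y). \end{align*} (The first two identities say that $(A,\cdot,\vartriangleright)$ is a commutative dendriform trialgebra.) Given an almost Poisson algebra $(B,\{\cdot,\cdot\},*)$, a $B$-module almost Poisson algebra is an almost Poisson algebra $(V,[\cdot,\cdot]_V,\cdot_V)$ with linear maps $\mu,\varrho:B\to\operatorname{End}(V)$ such that, for all $x,y\in B$ and $a,b\in V$, \begin{align*} \mu(x*y)&=\mu(x)\mu(y), & \varrho(x*y)&=\mu(y)\varrho(x)+\mu(x)\varrho(y),\\ \mu(\{x,y\})&=\varrho(x)\mu(y)-\mu(y)\varrho(x), & \mu(x)(a\cdot_V b)&=(\mu(x)a)\cdot_V b,\\ \varrho(x)(a\cdot_V b)&=(\varrho(x)a)\cdot_V b+a\cdot_V(\varrho(x)b), & [a,\mu(x)b]_V&=-(\varrho(x)a)\cdot_V b+\mu(x)[a,b]_V. \end{align*} Let $(A,[\cdot,\cdot],\diamond,\cdot,\vartriangleright)$ be an almost tridendriform Poisson algebra over $K$, and define $\mathcal L_\diamond,\mathcal L_\vartriangleright:A\to\operatorname{End}(A)$ by $\mathcal L_\diamond(x)y=x\diamond y$ and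 $\mathcal L_\vartriangleright(x)y=x\vartriangleright y$. Then $A^C=(A,\{\cdot,\cdot\},*)$, with $*$ and $\{\cdot,\cdot\}$ as above, is an almost Poisson algebra, and $(A,[\cdot,\cdot],\cdot)$ with $\mu=\mathcal L_\vartriangleright$ and $\varrho=\mathcal L_\diamond$ is an $A^C$-module almost Poisson algebra. -/

import Mathlib

/-- A commutative associative `K`-algebra `(A, m)` (no unit required). -/
structure IsCommAssoc {K A : Type*} [Field K] [AddCommGroup A] [Module K A]
    (m : A →ₗ[K] A →ₗ[K] A) : Prop where
  comm : ∀ x y, m x y = m y x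
  assoc : ∀ x y z, m (m x y) z = m x (m y z)

/-- An almost Poisson algebra `(A, br, m)`. -/
structure IsAlmostPoisson {K A : Type*} [Field K] [AddCommGroup A] [Module K A]
    (br m : A →ₗ[K] A →ₗ[K] A) : Prop where
  commAssoc : IsCommAssoc m
  skew : ∀ x y, br x y = - br y x
  leibniz : ∀ x y z, br x (m y z) = m (br x y) z + m y (br x z)

/-- The induced product `x ∗ y = x ▷ y + y ▷ x + x · y`, with `m` for `·` and `tr` for `▷`. -/
def inducedMul {K A : Type*} [Field K] [AddCommGroup A] [Module K A]
    (m tr : A →ₗ[K] A →ₗ[K] A) : A →ₗ[K] A →ₗ[K] A :=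
  tr + tr.flip + m

/-- The induced bracket `{x, y} = x ◇ y - y ◇ x + [x, y]`, with `br` for `[·,·]`
and `dia` for `◇`. -/
def inducedBracket {K A : Type*} [Field K] [AddCommGroup A] [Module K A]
    (br dia : A →ₗ[K] A →ₗ[K] A) : A →ₗ[K] A →ₗ[K] A :=
  dia - dia.flip + br

/-- A commutative dendriform trialgebra `(A, m, tr)`:
`(x ∗ y) ▷ z = x ▷ (y ▷ z)` for the induced product `∗`, and `(x ▷ y) · z = x ▷ (y · z)`. -/
structure IsCommDendriformTrialgebra {K A : Type*} [Field K] [AddCommGroup A] [Module K A]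
    (m tr : A →ₗ[K] A →ₗ[K] A) : Prop where
  commAssoc : IsCommAssoc m
  induced_tr : ∀ x y z, tr (inducedMul m tr x y) z = tr x (tr y z)
  tr_mul : ∀ x y z, m (tr x y) z = tr x (m y z)

/-- An almost tridendriform Poisson algebra `(A, br, dia, m, tr)`, that is,
`(A, [·,·], ◇, ·, ▷)`. -/
structure IsAlmostTridendriformPoisson {K A : Type*} [Field K] [AddCommGroup A] [Module K A]
    (br dia m tr : A →ₗ[K] A →ₗ[K] A) : Prop where
  almostPoisson : IsAlmostPoisson br m
  trialgebra : IsCommDendriformTrialgebra m tr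
  dia_mul : ∀ x y z, dia x (m y z) = m (dia x y) z + m y (dia x z)
  br_tr : ∀ x y z, br x (tr z y) = tr z (br x y) - m y (dia z x)
  induced_dia : ∀ x y z, dia (inducedMul m tr y z) x = tr z (dia y x) + tr y (dia z x)
  bracket_tr : ∀ x y z,
    tr (inducedBracket br dia x z) y = dia x (tr z y) - tr z (dia x y)

/-- `(V, ϱ, μ)` is a representation of the almost Poisson algebra `(B, br, m)`. -/
structure IsRepresentation {K B V : Type*} [Field K] [AddCommGroup B] [Module K B]
    [AddCommGroup V] [Module K V] (br m : B →ₗ[K] B →ₗ[K] B)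
    (ϱ μ : B →ₗ[K] Module.End K V) : Prop where
  mu_mul : ∀ x y, μ (m x y) = μ x * μ y
  rho_mul : ∀ x y, ϱ (m x y) = μ y * ϱ x + μ x * ϱ y
  mu_br : ∀ x y, μ (br x y) = ϱ x * μ y - μ y * ϱ x

/-- `(B, br, m)` is an almost Poisson algebra and `(V, mV, brV, μ, ϱ)` is a
`B`-module almost Poisson algebra. -/
structure IsModuleAlmostPoisson {K B V : Type*} [Field K] [AddCommGroup B] [Module K B]
    [AddCommGroup V] [Module K V] (br m : B →ₗ[K] B →ₗ[K] B)
    (brV mV : V →ₗ[K] V →ₗ[K] V) (μ ϱ : B →ₗ[K] Module.End K V) : Prop where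
  base : IsAlmostPoisson br m
  fiber : IsAlmostPoisson brV mV
  rep : IsRepresentation br m ϱ μ
  mu_mulV : ∀ x a b, μ x (mV a b) = mV (μ x a) b
  rho_mulV : ∀ x a b, ϱ x (mV a b) = mV (ϱ x a) b + mV a (ϱ x b)
  brV_mu : ∀ x a b, brV a (μ x b) = - mV (ϱ x a) b + μ x (brV a b)

/-- The map `L : A → End(A)`, `L(x) y = op x y`, of left multiplications of a bilinear
operation. -/
def leftMult {K A : Type*} [Field K] [AddCommGroup A] [Module K A]
    (op : A →ₗ[K] A →ₗ[K] A) : A →ₗ[K] Module.End K A where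
  toFun x := op x
  map_add' x y := op.map_add x y
  map_smul' c x := op.map_smul c x

theorem inducedMul_apply {K A : Type*} [Field K] [AddCommGroup A] [Module K A]
    (m tr : A →ₗ[K] A →ₗ[K] A) (x y : A) :
    inducedMul m tr x y = tr x y + tr y x + m x y := rfl

theorem inducedBracket_apply {K A : Type*} [Field K] [AddCommGroup A] [Module K A]
    (br dia : A →ₗ[K] A →ₗ[K] A) (x y : A) :
    inducedBracket br dia x y = dia x y - dia y x + br x y := rfl

/-- The induced product of a commutative dendriform trialgebra is commutative and
associative. -/
theorem IsCommDendriformTrialgebra.isCommAssoc_inducedMul {K A : Type*} [Field K]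
    [AddCommGroup A] [Module K A] {m tr : A →ₗ[K] A →ₗ[K] A}
    (h : IsCommDendriformTrialgebra m tr) : IsCommAssoc (inducedMul m tr) := by
  have comm : ∀ x y, inducedMul m tr x y = inducedMul m tr y x := fun x y => by
    rw [inducedMul_apply, inducedMul_apply, h.commAssoc.comm x y, add_comm (tr x y)]
  refine ⟨comm, fun x y z => ?_⟩
  have tr_comm : ∀ a b c, tr a (tr b c) = tr b (tr a c) := fun a b c => by
    rw [← h.induced_tr, ← h.induced_tr, comm a b]
  have mul_tr : ∀ a b c, m a (tr b c) = tr b (m a c) := fun a b c => by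
    rw [h.commAssoc.comm, h.tr_mul, h.commAssoc.comm]
  rw [inducedMul_apply m tr (inducedMul m tr x y) z,
    inducedMul_apply m tr x (inducedMul m tr y z), h.induced_tr, h.induced_tr]
  simp only [inducedMul_apply, map_add, LinearMap.add_apply, h.tr_mul, mul_tr,
    h.commAssoc.assoc, tr_comm z]
  abel

/-- The almost Poisson algebra associated with an almost tridendriform Poisson algebra. -/
theorem IsAlmostTridendriformPoisson.isAlmostPoisson_induced {K A : Type*} [Field K]
    [AddCommGroup A] [Module K A] {br dia m tr : A →ₗ[K] A →ₗ[K] A}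
    (h : IsAlmostTridendriformPoisson br dia m tr) :
    IsAlmostPoisson (inducedBracket br dia) (inducedMul m tr) where
  commAssoc := h.trialgebra.isCommAssoc_inducedMul
  skew x y := by
    rw [inducedBracket_apply, inducedBracket_apply, h.almostPoisson.skew x y]
    abel
  leibniz x y z := by
    have dia_tr : ∀ b c, dia x (tr b c) =
        tr (inducedBracket br dia x b) c + tr b (dia x c) := fun b c => by
      rw [h.bracket_tr, sub_add_cancel]
    rw [inducedBracket_apply br dia x (inducedMul m tr y z), h.induced_dia]
    simp only [inducedMul_apply, map_add, dia_tr, h.br_tr, h.dia_mul, h.almostPoisson.leibniz]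
    simp only [inducedBracket_apply, map_add, map_sub, LinearMap.add_apply,
      LinearMap.sub_apply, h.almostPoisson.commAssoc.comm z]
    abel

/-- `(A, [·,·], ·, L_◇, L_▷)` is an `A^C`-module almost Poisson algebra over the associated
almost Poisson algebra `A^C = (A, ∗, {·,·})`; here `L_▷` plays the role of `μ` and `L_◇` that
of `ϱ`. -/
theorem stmt9 {K A : Type*} [Field K] [CharZero K] [AddCommGroup A] [Module K A]
    (br dia m tr : A →ₗ[K] A →ₗ[K] A) (h : IsAlmostTridendriformPoisson br dia m tr) :
    IsModuleAlmostPoisson (inducedBracket br dia) (inducedMul m tr) br m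
      (leftMult tr) (leftMult dia) := by
  have comm := h.almostPoisson.commAssoc.comm
  exact
    { base := h.isAlmostPoisson_induced
      fiber := h.almostPoisson
      rep :=
        { mu_mul := fun x y => LinearMap.ext fun z => h.trialgebra.induced_tr x y z
          rho_mul := fun x y => LinearMap.ext fun z => h.induced_dia z x y
          mu_br := fun x y => LinearMap.ext fun z => h.bracket_tr x z y }
      mu_mulV := fun x a b => (h.trialgebra.tr_mul x a b).symm
      rho_mulV := h.dia_mul
      brV_mu := fun x a b => by
        change br a (tr x b) = -m (dia x a) b + tr x (br a b)
        rw [h.br_tr, comm b, sub_eq_neg_add] }
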